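/- The eight points P1 = (0:1:1), P2 = (0:14:13), P3 = (1:0:1), P4 = (21:0:13), P5 = (1:1:1), P6 = (6:6:−1), P7 = (−2:2:1), P8 = (−3:3:−1) of ℙ²(ℚ) are in general position. -/

import Mathlib

open MvPolynomial

noncomputable section

variable {k : Type*} [Field k]

/-- The projective plane over `k`. -/
abbrev P2 (k : Type*) [Field k] := Projectivization k (Fin 3 → k)

lemma ne_zero_of_coord {k : Type*} [Field k] {x y z : k} (i : Fin 3)
    (h : ![x, y, z] i ≠ 0) : ![x, y, z] ≠ 0 :=
  fun h0 => h (by rw [h0]; rfl)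

/-- The point of the projective plane with homogeneous coordinates `(x : y : z)`. -/
def pt (x y z : k) (h : ![x, y, z] ≠ 0) : P2 k := Projectivization.mk k ![x, y, z] h

/-- A homogeneous form vanishes at a projective point. -/
def VanishesAt (F : MvPolynomial (Fin 3) k) (P : P2 k) : Prop :=
  eval P.rep F = 0

/-- A form is singular at a projective point: all three partial derivatives vanish there. -/
def SingularAt (F : MvPolynomial (Fin 3) k) (P : P2 k) : Prop :=
  ∀ i : Fin 3, eval P.rep (pderiv i F) = 0

/-- Eight points of the projective plane are in general position. -/
def GeneralPosition (p : Fin 8 → P2 k) : Prop :=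
  Function.Injective p ∧
  (∀ i j l : Fin 8, i ≠ j → i ≠ l → j ≠ l →
    LinearIndependent k ![(p i).rep, (p j).rep, (p l).rep]) ∧
  (¬ ∃ F : MvPolynomial (Fin 3) k, F ≠ 0 ∧ F.IsHomogeneous 2 ∧
    ∃ s : Finset (Fin 8), s.card = 6 ∧ ∀ i ∈ s, VanishesAt F (p i)) ∧
  (¬ ∃ F : MvPolynomial (Fin 3) k, F ≠ 0 ∧ F.IsHomogeneous 3 ∧
    (∀ i, VanishesAt F (p i)) ∧ ∃ i, SingularAt F (p i))

lemma MvPolynomial.IsHomogeneous.exists_eq_sum {k : Type*} [Field k] {n : ℕ}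
    {F : MvPolynomial (Fin 3) k} (hF : F.IsHomogeneous n) :
    ∃ c : (Fin 3 → ℕ) → k, F = ∑ f ∈ Finset.Nat.antidiagonalTuple 3 n,
      monomial (Finsupp.equivFunOnFinite.symm f) (c f) := by
  refine ⟨fun f => coeff (Finsupp.equivFunOnFinite.symm f) F, ?_⟩
  ext d
  rw [coeff_sum]
  simp only [coeff_monomial]
  by_cases hd : d.degree = n
  · rw [Finset.sum_eq_single (⇑d)]
    · simp
    · intro f _ hf
      rw [if_neg]
      rintro rfl
      exact hf rfl
    · intro h
      refine absurd ?_ h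
      rw [Finset.Nat.mem_antidiagonalTuple, ← hd, Finsupp.degree_eq_sum]
  · rw [hF.coeff_eq_zero hd, Finset.sum_eq_zero]
    intro f hf
    rw [if_neg]
    rintro rfl
    apply hd
    rw [Finset.Nat.mem_antidiagonalTuple] at hf
    rw [Finsupp.degree_eq_sum]
    exact hf

lemma MvPolynomial.IsHomogeneous.eval_rep_mk_eq_zero_iff {k : Type*} [Field k] {n : ℕ}
    {F : MvPolynomial (Fin 3) k} (hF : F.IsHomogeneous n) {v : Fin 3 → k} (hv : v ≠ 0) :
    eval (Projectivization.mk k v hv).rep F = 0 ↔ eval v F = 0 := by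
  obtain ⟨a, ha⟩ := Projectivization.exists_smul_eq_mk_rep k v hv
  rw [← ha]
  have : eval (a • v) F = (a : k) ^ n * eval v F := by
    rw [eval_eq', eval_eq', Finset.mul_sum]
    refine Finset.sum_congr rfl fun d hd => ?_
    have hdeg : ∑ i, d i = n := by
      rw [← Finsupp.degree_eq_sum]
      by_contra h
      exact mem_support_iff.mp hd (hF.coeff_eq_zero h)
    simp only [Pi.smul_apply, Units.smul_def, smul_eq_mul, mul_pow, Finset.prod_mul_distrib,
      Finset.prod_pow_eq_pow_sum, hdeg]
    ring
  simp [this]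

/-- Integer representatives of the eight points. -/
def exampleCoords : Fin 8 → Fin 3 → ℤ :=
  ![![0, 1, 1], ![0, 14, 13], ![1, 0, 1], ![21, 0, 13], ![1, 1, 1], ![6, 6, -1], ![-2, 2, 1],
    ![-3, 3, -1]]

lemma det_exampleCoords_ne_zero : ∀ i j l : Fin 8, i ≠ j → i ≠ l → j ≠ l →
    (Matrix.of ![exampleCoords i, exampleCoords j, exampleCoords l]).det ≠ 0 := by
  simp only [Matrix.det_fin_three]
  decide +kernel

/-- Coefficients of two linear relations between the values of a ternary quadratic form at the
vectors `exampleCoords`. -/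
def conicRelation : Fin 2 → Fin 8 → ℤ :=
  ![![896, -10, 700, -4, 640, -3, 133, 0], ![60984, -360, -4725, -11, 5940, -32, 0, 532]]

lemma conicRelation_minor_ne_zero : ∀ i j : Fin 8, i ≠ j →
    conicRelation 0 i * conicRelation 1 j - conicRelation 0 j * conicRelation 1 i ≠ 0 := by
  decide +kernel

/-- The vector `exampleCoords i` with rational entries. -/
def exampleVec (i : Fin 8) : Fin 3 → ℚ := fun m => exampleCoords i m

lemma exampleVec_ne_zero (i : Fin 8) : exampleVec i ≠ 0 := by
  have h : ∀ i : Fin 8, ∃ m, exampleCoords i m ≠ 0 := by decide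
  obtain ⟨m, hm⟩ := h i
  exact fun h0 => hm (Int.cast_eq_zero.mp (congrFun h0 m))

/-- The eight points, indexed through `exampleVec`. -/
def examplePoint (i : Fin 8) : P2 ℚ := Projectivization.mk ℚ (exampleVec i) (exampleVec_ne_zero i)

lemma linearIndependent_exampleVec {i j l : Fin 8} (hij : i ≠ j) (hil : i ≠ l) (hjl : j ≠ l) :
    LinearIndependent ℚ ![exampleVec i, exampleVec j, exampleVec l] := by
  have hdet : (Matrix.of ![exampleVec i, exampleVec j, exampleVec l]).det ≠ 0 := by
    have h := det_exampleCoords_ne_zero i j l hij hil hjl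
    rw [Matrix.det_fin_three] at h ⊢
    simp only [Matrix.of_apply, Matrix.cons_val, exampleVec] at h ⊢
    exact_mod_cast h
  exact Matrix.linearIndependent_rows_iff_isUnit.mpr
    ((Matrix.isUnit_iff_isUnit_det _).mpr hdet.isUnit)

lemma linearIndependent_examplePoint_rep {i j l : Fin 8} (hij : i ≠ j) (hil : i ≠ l)
    (hjl : j ≠ l) :
    LinearIndependent ℚ ![(examplePoint i).rep, (examplePoint j).rep, (examplePoint l).rep] := by
  choose a ha using fun i => Projectivization.exists_smul_eq_mk_rep ℚ (exampleVec i)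
    (exampleVec_ne_zero i)
  convert (linearIndependent_exampleVec hij hil hjl).units_smul ![a i, a j, a l] using 1
  ext m
  fin_cases m <;> simp [examplePoint, ← ha]

lemma examplePoint_injective : Function.Injective examplePoint := by
  intro i j h
  by_contra hij
  obtain ⟨l, hil, hjl⟩ : ∃ l, i ≠ l ∧ j ≠ l := by
    clear h
    revert i j
    decide
  have h01 : (0 : Fin 3) = 1 := (linearIndependent_examplePoint_rep hij hil hjl).injective
    (by simp [h])
  exact absurd h01 (by decide)

lemma vanishesAt_examplePoint_iff {n : ℕ} {F : MvPolynomial (Fin 3) ℚ} (hF : F.IsHomogeneous n)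
    (i : Fin 8) : VanishesAt F (examplePoint i) ↔ eval (exampleVec i) F = 0 :=
  hF.eval_rep_mk_eq_zero_iff _

lemma singularAt_examplePoint_iff {n : ℕ} {F : MvPolynomial (Fin 3) ℚ} (hF : F.IsHomogeneous n)
    (i : Fin 8) :
    SingularAt F (examplePoint i) ↔ ∀ m, eval (exampleVec i) (pderiv m F) = 0 :=
  forall_congr' fun _ => hF.pderiv.eval_rep_mk_eq_zero_iff _

lemma antidiagonalTuple_three_two : Finset.Nat.antidiagonalTuple 3 2 =
    {![2, 0, 0], ![0, 2, 0], ![0, 0, 2], ![1, 1, 0], ![1, 0, 1], ![0, 1, 1]} := by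
  decide

lemma antidiagonalTuple_three_three : Finset.Nat.antidiagonalTuple 3 3 =
    {![3, 0, 0], ![0, 3, 0], ![0, 0, 3], ![2, 1, 0], ![2, 0, 1], ![1, 2, 0], ![0, 2, 1],
      ![1, 0, 2], ![0, 1, 2], ![1, 1, 1]} := by
  decide

lemma sum_conicRelation_mul_eval {F : MvPolynomial (Fin 3) ℚ} (hF : F.IsHomogeneous 2)
    (r : Fin 2) : ∑ i, (conicRelation r i : ℚ) * eval (exampleVec i) F = 0 := by
  obtain ⟨c, rfl⟩ := hF.exists_eq_sum
  rw [antidiagonalTuple_three_two]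
  fin_cases r <;>
  · simp [eval_monomial, Finsupp.prod_fintype, Fin.prod_univ_three, Fin.sum_univ_eight,
      exampleVec, exampleCoords, conicRelation]
    ring

lemma eq_zero_of_isHomogeneous_two {F : MvPolynomial (Fin 3) ℚ} (hF : F.IsHomogeneous 2)
    (h : ∀ i, eval (exampleVec i) F = 0) : F = 0 := by
  obtain ⟨c, rfl⟩ := hF.exists_eq_sum
  suffices hc : ∀ f ∈ Finset.Nat.antidiagonalTuple 3 2, c f = 0 from
    Finset.sum_eq_zero fun f hf => by rw [hc f hf, monomial_zero]
  rw [antidiagonalTuple_three_two] at h ⊢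
  simp [Fin.forall_fin_succ, eval_monomial, Finsupp.prod_fintype, Fin.prod_univ_three,
    exampleVec, exampleCoords] at h
  obtain ⟨h0, h1, h2, h3, h4, h5, h6, h7⟩ := h
  simp only [Finset.forall_mem_insert, Finset.mem_singleton, forall_eq]
  refine ⟨?_, ?_, ?_, ?_, ?_, ?_⟩ <;> linarith

lemma eq_zero_of_vanishesAt_six {F : MvPolynomial (Fin 3) ℚ} (hF : F.IsHomogeneous 2)
    {s : Finset (Fin 8)} (hs : s.card = 6) (h : ∀ i ∈ s, eval (exampleVec i) F = 0) : F = 0 := by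
  have hsc : sᶜ.card = 2 := by rw [Finset.card_compl, hs, Fintype.card_fin]
  obtain ⟨i, j, hij, hsij⟩ := Finset.card_eq_two.mp hsc
  have hl : ∀ l, l ≠ i ∧ l ≠ j → eval (exampleVec l) F = 0 := by
    intro l hl
    refine h l ?_
    by_contra hls
    rw [← Finset.mem_compl, hsij] at hls
    simp [hl] at hls
  have hrel (r : Fin 2) : (conicRelation r i : ℚ) * eval (exampleVec i) F +
      conicRelation r j * eval (exampleVec j) F = 0 := by
    rw [← sum_conicRelation_mul_eval hF r, Fintype.sum_eq_add i j hij]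
    intro l hlij
    rw [hl l hlij, mul_zero]
  have hminor : (conicRelation 0 i * conicRelation 1 j - conicRelation 0 j * conicRelation 1 i : ℚ)
      ≠ 0 := by
    exact_mod_cast conicRelation_minor_ne_zero i j hij
  have hi : eval (exampleVec i) F = 0 := by
    refine (mul_eq_zero.mp ?_).resolve_left hminor
    linear_combination (conicRelation 1 j : ℚ) * hrel 0 - conicRelation 0 j * hrel 1
  have hj : eval (exampleVec j) F = 0 := by
    refine (mul_eq_zero.mp ?_).resolve_left hminor
    linear_combination (conicRelation 0 i : ℚ) * hrel 1 - conicRelation 1 i * hrel 0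
  refine eq_zero_of_isHomogeneous_two hF fun l => ?_
  by_cases hli : l = i
  · rw [hli, hi]
  by_cases hlj : l = j
  · rw [hlj, hj]
  exact hl l ⟨hli, hlj⟩

lemma MvPolynomial.IsHomogeneous.exists_cubic_coeffs {k : Type*} [Field k]
    {F : MvPolynomial (Fin 3) k} (hF : F.IsHomogeneous 3) :
    ∃ c : Fin 10 → k, F = C (c 0) * X 0 ^ 3 + C (c 1) * X 1 ^ 3 + C (c 2) * X 2 ^ 3 +
      C (c 3) * (X 0 ^ 2 * X 1) + C (c 4) * (X 0 ^ 2 * X 2) + C (c 5) * (X 0 * X 1 ^ 2) +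
      C (c 6) * (X 1 ^ 2 * X 2) + C (c 7) * (X 0 * X 2 ^ 2) + C (c 8) * (X 1 * X 2 ^ 2) +
      C (c 9) * (X 0 * X 1 * X 2) := by
  obtain ⟨c, rfl⟩ := hF.exists_eq_sum
  refine ⟨![c ![3, 0, 0], c ![0, 3, 0], c ![0, 0, 3], c ![2, 1, 0], c ![2, 0, 1], c ![1, 2, 0],
    c ![0, 2, 1], c ![1, 0, 2], c ![0, 1, 2], c ![1, 1, 1]], ?_⟩
  rw [antidiagonalTuple_three_three]
  simp [monomial_eq, Finsupp.prod_fintype, Fin.prod_univ_three]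
  ring

lemma eq_zero_of_isHomogeneous_three {F : MvPolynomial (Fin 3) ℚ} (hF : F.IsHomogeneous 3)
    (h : ∀ i, eval (exampleVec i) F = 0) {i : Fin 8}
    (hi : ∀ m, eval (exampleVec i) (pderiv m F) = 0) : F = 0 := by
  obtain ⟨c, rfl⟩ := hF.exists_cubic_coeffs
  suffices hc : ∀ m, c m = 0 by simp [hc]
  simp [Fin.forall_fin_succ, exampleVec, exampleCoords] at h
  obtain ⟨h0, h1, h2, h3, h4, h5, h6, h7⟩ := h
  obtain ⟨a, ha⟩ : ∃ a, c 1 = 78 * a := ⟨c 1 / 78, by ring⟩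
  obtain ⟨b, hb⟩ : ∃ b, c 0 = 104 * b := ⟨c 0 / 104, by ring⟩
  have e2 : c 2 = 210 * a + 378 * b := by linarith
  have e3 : c 3 = -42 * a + 90 * b := by linarith
  have e4 : c 4 = 130 * a - 38 * b := by linarith
  have e5 : c 5 = 45 * a - 51 * b := by linarith
  have e6 : c 6 = 33 * a + 351 * b := by linarith
  have e7 : c 7 = -340 * a - 444 * b := by linarith
  have e8 : c 8 = -321 * a - 729 * b := by linarith
  have e9 : c 9 = 207 * a + 339 * b := by linarith
  simp only [Fin.forall_fin_succ, map_add, Derivation.leibniz, Derivation.leibniz_pow, pderiv_C,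
    pderiv_X] at hi
  simp [Pi.single_apply, ha, hb, e2, e3, e4, e5, e6, e7, e8, e9] at hi
  obtain ⟨k0, k1, k2⟩ := hi
  have hab : a = 0 ∧ b = 0 := by
    clear * - k0 k1 k2
    fin_cases i <;>
    · simp [exampleVec, exampleCoords] at k0 k1 k2
      constructor <;> linarith
  obtain ⟨rfl, rfl⟩ := hab
  intro m
  fin_cases m <;> simp [*]

theorem example_points_general_position_Q :
    GeneralPosition
    ![pt (0 : ℚ) 1 1 (ne_zero_of_coord 1 (by norm_num)),
      pt (0 : ℚ) 14 13 (ne_zero_of_coord 1 (by norm_num)),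
      pt (1 : ℚ) 0 1 (ne_zero_of_coord 0 (by norm_num)),
      pt (21 : ℚ) 0 13 (ne_zero_of_coord 0 (by norm_num)),
      pt (1 : ℚ) 1 1 (ne_zero_of_coord 0 (by norm_num)),
      pt (6 : ℚ) 6 (-1) (ne_zero_of_coord 0 (by norm_num)),
      pt (-2 : ℚ) 2 1 (ne_zero_of_coord 1 (by norm_num)),
      pt (-3 : ℚ) 3 (-1) (ne_zero_of_coord 1 (by norm_num))] := by
  suffices h : GeneralPosition examplePoint by
    convert h using 1
    have mk_congr {v w : Fin 3 → ℚ} (hv : v ≠ 0) (hw : w ≠ 0) (hvw : v = w) :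
        Projectivization.mk ℚ v hv = Projectivization.mk ℚ w hw := by
      subst hvw
      rfl
    funext i
    fin_cases i <;>
    · refine mk_congr _ _ ?_
      ext m
      fin_cases m <;> simp [exampleVec, exampleCoords]
  refine ⟨examplePoint_injective, fun i j l => linearIndependent_examplePoint_rep, ?_, ?_⟩
  · rintro ⟨F, hF0, hF, s, hs, h⟩
    exact hF0 (eq_zero_of_vanishesAt_six hF hs fun i hi =>
      (vanishesAt_examplePoint_iff hF i).mp (h i hi))
  · rintro ⟨F, hF0, hF, h, i, hi⟩
    exact hF0 (eq_zero_of_isHomogeneous_three hF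
      (fun i => (vanishesAt_examplePoint_iff hF i).mp (h i))
      ((singularAt_examplePoint_iff hF i).mp hi))

end
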